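/- Let K be a semifield and h ∈ I. If (i,a) ∼ (i',a') in ℐ×K^ν (i.e. they lie in the same equivalence class under the relation generated by adjacency), then ||i,a||_h = ||i',a'||_h. In particular, for every equivalence class A ∈ 𝒰_K and every h ∈ I there is a well-defined element ||A||_h ∈ K, equal to ||i,a||_h for any representative (i,a) of A. -/

import Mathlib

open scoped BigOperators

namespace Lusztig

variable {I : Type*} [Fintype I] [DecidableEq I]

/-- A simply laced Cartan matrix: symmetric, positive definite, integer entries,
`2` on the diagonal and `0` or `-1` off the diagonal. -/
structure IsSimplyLacedCartan (A : Matrix I I ℤ) : Prop where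
  symm : ∀ i j, A i j = A j i
  posDef : ∀ x : I → ℤ, x ≠ 0 → 0 < ∑ i, ∑ j, x i * A i j * x j
  diag : ∀ i, A i i = 2
  offDiag : ∀ i j, i ≠ j → A i j = 0 ∨ A i j = -1

/-- The simple reflection `s_i` acting on `ℤ[I] = I → ℤ`, `s_i(j') = j' - a_{ij} i'`. -/
def sE (A : Matrix I I ℤ) (i : I) : Function.End (I → ℤ) :=
  fun x => x - (∑ j, A i j * x j) • Pi.single i 1

/-- The length of `w`: the least `n` such that `w` is a product of `n` simple
reflections (`∞` convention: `sInf ∅ = 0`). -/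
noncomputable def len (A : Matrix I I ℤ) (w : Function.End (I → ℤ)) : ℕ :=
  sInf {n | ∃ l : List I, l.length = n ∧ (l.map (sE A)).prod = w}

/-- `w₀` is the longest element of `W = ⟨s_i⟩` and `ν = |w₀|`. -/
structure IsLongest (A : Matrix I I ℤ) (w₀ : Function.End (I → ℤ)) (ν : ℕ) : Prop where
  mem : ∃ l : List I, (l.map (sE A)).prod = w₀
  len_eq : len A w₀ = ν
  longest : ∀ w : Function.End (I → ℤ),
    (∃ l : List I, (l.map (sE A)).prod = w) → len A w ≤ ν

/-- `ℐ`: the set of sequences `(i_1, …, i_ν)` with `s_{i_1} ⋯ s_{i_ν} = w₀`. -/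
def RedWord (A : Matrix I I ℤ) (w₀ : Function.End (I → ℤ)) (ν : ℕ) :
    Set (Fin ν → I) :=
  {f | ((List.ofFn f).map (sE A)).prod = w₀}

/-- The coefficient `r_{h,k}` defined by
`s_{i_1} ⋯ s_{i_{k-1}} (i_k') = Σ_h r_{h,k} h'` (here `k` is `0`-indexed). -/
def rCoef (A : Matrix I I ℤ) {ν : ℕ} (f : Fin ν → I) (h : I) (k : Fin ν) : ℤ :=
  ((List.ofFn fun m : Fin (k : ℕ) => sE A (f (Fin.castLE k.2.le m))).prod :
    Function.End (I → ℤ)) (Pi.single (f k) 1) h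

/-- `‖i,a‖_h = Π_k a_k^{r_{h,k}}`. -/
def normAt (A : Matrix I I ℤ) {ν : ℕ} {K : Type*} [CommGroup K]
    (f : Fin ν → I) (a : Fin ν → K) (h : I) : K :=
  ∏ k : Fin ν, a k ^ rCoef A f h k

section Semifield

variable {K : Type*} [CommGroup K] [AddCommSemigroup K]

/-- Adjacency of two pairs in `ℐ × K^ν`, for a semifield `K` (written
multiplicatively, with addition `+`). -/
def Adjacent (A : Matrix I I ℤ) (w₀ : Function.End (I → ℤ)) (ν : ℕ)
    (p q : (Fin ν → I) × (Fin ν → K)) : Prop :=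
  p.1 ∈ RedWord A w₀ ν ∧ q.1 ∈ RedWord A w₀ ν ∧
  ((∃ (l : ℕ) (h0 : l < ν) (h1 : l + 1 < ν) (h2 : l + 2 < ν),
      A (p.1 ⟨l, h0⟩) (p.1 ⟨l + 1, h1⟩) = -1 ∧
      p.1 ⟨l + 2, h2⟩ = p.1 ⟨l, h0⟩ ∧
      q.1 ⟨l, h0⟩ = p.1 ⟨l + 1, h1⟩ ∧ q.1 ⟨l + 1, h1⟩ = p.1 ⟨l, h0⟩ ∧
      q.1 ⟨l + 2, h2⟩ = p.1 ⟨l + 1, h1⟩ ∧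
      (∀ k : Fin ν, (k : ℕ) ≠ l → (k : ℕ) ≠ l + 1 → (k : ℕ) ≠ l + 2 →
        q.1 k = p.1 k ∧ q.2 k = p.2 k) ∧
      q.2 ⟨l, h0⟩ =
        p.2 ⟨l + 1, h1⟩ * p.2 ⟨l + 2, h2⟩ * (p.2 ⟨l, h0⟩ + p.2 ⟨l + 2, h2⟩)⁻¹ ∧
      q.2 ⟨l + 1, h1⟩ = p.2 ⟨l, h0⟩ + p.2 ⟨l + 2, h2⟩ ∧
      q.2 ⟨l + 2, h2⟩ =
        p.2 ⟨l, h0⟩ * p.2 ⟨l + 1, h1⟩ * (p.2 ⟨l, h0⟩ + p.2 ⟨l + 2, h2⟩)⁻¹) ∨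
   (∃ (l : ℕ) (h0 : l < ν) (h1 : l + 1 < ν),
      A (p.1 ⟨l, h0⟩) (p.1 ⟨l + 1, h1⟩) = 0 ∧
      q.1 ⟨l, h0⟩ = p.1 ⟨l + 1, h1⟩ ∧ q.1 ⟨l + 1, h1⟩ = p.1 ⟨l, h0⟩ ∧
      (∀ k : Fin ν, (k : ℕ) ≠ l → (k : ℕ) ≠ l + 1 →
        q.1 k = p.1 k ∧ q.2 k = p.2 k) ∧
      q.2 ⟨l, h0⟩ = p.2 ⟨l + 1, h1⟩ ∧ q.2 ⟨l + 1, h1⟩ = p.2 ⟨l, h0⟩))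

end Semifield

/-- Adjacency of two pairs in `ℐ × ℤ^ν` for the tropical semifield `ℤ`
(sum = `min`, product = `+`). -/
def TAdjacent (A : Matrix I I ℤ) (w₀ : Function.End (I → ℤ)) (ν : ℕ)
    (p q : (Fin ν → I) × (Fin ν → ℤ)) : Prop :=
  p.1 ∈ RedWord A w₀ ν ∧ q.1 ∈ RedWord A w₀ ν ∧
  ((∃ (l : ℕ) (h0 : l < ν) (h1 : l + 1 < ν) (h2 : l + 2 < ν),
      A (p.1 ⟨l, h0⟩) (p.1 ⟨l + 1, h1⟩) = -1 ∧
      p.1 ⟨l + 2, h2⟩ = p.1 ⟨l, h0⟩ ∧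
      q.1 ⟨l, h0⟩ = p.1 ⟨l + 1, h1⟩ ∧ q.1 ⟨l + 1, h1⟩ = p.1 ⟨l, h0⟩ ∧
      q.1 ⟨l + 2, h2⟩ = p.1 ⟨l + 1, h1⟩ ∧
      (∀ k : Fin ν, (k : ℕ) ≠ l → (k : ℕ) ≠ l + 1 → (k : ℕ) ≠ l + 2 →
        q.1 k = p.1 k ∧ q.2 k = p.2 k) ∧
      q.2 ⟨l, h0⟩ =
        p.2 ⟨l + 1, h1⟩ + p.2 ⟨l + 2, h2⟩ - min (p.2 ⟨l, h0⟩) (p.2 ⟨l + 2, h2⟩) ∧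
      q.2 ⟨l + 1, h1⟩ = min (p.2 ⟨l, h0⟩) (p.2 ⟨l + 2, h2⟩) ∧
      q.2 ⟨l + 2, h2⟩ =
        p.2 ⟨l, h0⟩ + p.2 ⟨l + 1, h1⟩ - min (p.2 ⟨l, h0⟩) (p.2 ⟨l + 2, h2⟩)) ∨
   (∃ (l : ℕ) (h0 : l < ν) (h1 : l + 1 < ν),
      A (p.1 ⟨l, h0⟩) (p.1 ⟨l + 1, h1⟩) = 0 ∧
      q.1 ⟨l, h0⟩ = p.1 ⟨l + 1, h1⟩ ∧ q.1 ⟨l + 1, h1⟩ = p.1 ⟨l, h0⟩ ∧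
      (∀ k : Fin ν, (k : ℕ) ≠ l → (k : ℕ) ≠ l + 1 →
        q.1 k = p.1 k ∧ q.2 k = p.2 k) ∧
      q.2 ⟨l, h0⟩ = p.2 ⟨l + 1, h1⟩ ∧ q.2 ⟨l + 1, h1⟩ = p.2 ⟨l, h0⟩))

theorem sE_apply (A : Matrix I I ℤ) (i : I) (x : I → ℤ) :
    sE A i x = x - (A.mulVec x) i • Pi.single i 1 := rfl

theorem sE_add (A : Matrix I I ℤ) (i : I) (x y : I → ℤ) :
    sE A i (x + y) = sE A i x + sE A i y := by
  simp only [sE_apply, Matrix.mulVec_add, Pi.add_apply]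
  module

theorem sE_single (A : Matrix I I ℤ) (i j : I) :
    sE A i (Pi.single j 1) = Pi.single j 1 - A i j • Pi.single i 1 := by
  rw [sE_apply, Matrix.mulVec_single_one, Matrix.col_apply]

theorem mulVec_sE (A : Matrix I I ℤ) (i j : I) (x : I → ℤ) :
    (A.mulVec (sE A i x)) j = A.mulVec x j - A.mulVec x i * A j i := by
  rw [sE_apply, Matrix.mulVec_sub, Matrix.mulVec_smul, Matrix.mulVec_single_one]
  rfl

theorem sE_commute {A : Matrix I I ℤ} {i j : I} (hij : A i j = 0) (hji : A j i = 0) :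
    sE A i * sE A j = sE A j * sE A i := by
  funext x
  change sE A i (sE A j x) = sE A j (sE A i x)
  rw [sE_apply A i, sE_apply A j (sE A i x), mulVec_sE, mulVec_sE, hij, hji,
    sE_apply, sE_apply]
  module

theorem sE_braid {A : Matrix I I ℤ} {i j : I} (hi : A i i = 2) (hj : A j j = 2)
    (hij : A i j = -1) (hji : A j i = -1) :
    sE A i * sE A j * sE A i = sE A j * sE A i * sE A j := by
  funext x
  change sE A i (sE A j (sE A i x)) = sE A j (sE A i (sE A j x))
  simp only [↓sE_apply, ↓mulVec_sE, hi, hj, hij, hji]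
  module

/-- The product `s_{i_1} ⋯ s_{i_k}` of the first `k` simple reflections of a word. -/
def prefixProd (A : Matrix I I ℤ) {ν : ℕ} (f : Fin ν → I) (k : ℕ) (hk : k ≤ ν) :
    Function.End (I → ℤ) :=
  (List.ofFn fun m : Fin k => sE A (f (Fin.castLE hk m))).prod

theorem rCoef_eq_prefixProd (A : Matrix I I ℤ) {ν : ℕ} (f : Fin ν → I) (h : I) (k : ℕ)
    (hk : k < ν) :
    rCoef A f h ⟨k, hk⟩ = prefixProd A f k hk.le (Pi.single (f ⟨k, hk⟩) 1) h := rfl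

theorem prefixProd_succ (A : Matrix I I ℤ) {ν : ℕ} (f : Fin ν → I) (k : ℕ) (hk : k < ν) :
    prefixProd A f (k + 1) hk = prefixProd A f k hk.le * sE A (f ⟨k, hk⟩) := by
  unfold prefixProd
  rw [List.ofFn_succ', List.prod_concat]
  rfl

theorem prefixProd_add (A : Matrix I I ℤ) {ν : ℕ} (f : Fin ν → I) (k : ℕ) (hk : k ≤ ν)
    (x y : I → ℤ) :
    prefixProd A f k hk (x + y) = prefixProd A f k hk x + prefixProd A f k hk y := by
  induction k generalizing x y with
  | zero => rfl
  | succ k ih =>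
    rw [prefixProd_succ]
    change prefixProd A f k _ (sE A _ (x + y)) = _
    rw [sE_add, ih]
    rfl

theorem prefixProd_congr_of_le (A : Matrix I I ℤ) {ν : ℕ} {f g : Fin ν → I} {m n : ℕ}
    (hmn : m ≤ n) (hn : n ≤ ν)
    (hm : prefixProd A f m (hmn.trans hn) = prefixProd A g m (hmn.trans hn))
    (hfg : ∀ k : Fin ν, m ≤ k → (k : ℕ) < n → f k = g k) :
    prefixProd A f n hn = prefixProd A g n hn := by
  induction n, hmn using Nat.le_induction with
  | base => exact hm
  | succ n hmn ih =>
    rw [prefixProd_succ, prefixProd_succ, hfg ⟨n, hn⟩ hmn n.lt_succ_self,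
      ih (n.le_succ.trans hn) hm fun k h₁ h₂ => hfg k h₁ (h₂.trans n.lt_succ_self)]

theorem prod_eq_prod_of_eq_off {ι M : Type*} [Fintype ι] [DecidableEq ι] [CommMonoid M]
    (s : Finset ι) {F G : ι → M} (hs : ∏ k ∈ s, F k = ∏ k ∈ s, G k)
    (h : ∀ k ∉ s, F k = G k) : ∏ k, F k = ∏ k, G k := by
  rw [← Finset.prod_mul_prod_compl s F, ← Finset.prod_mul_prod_compl s G, hs]
  congr 1
  exact Finset.prod_congr rfl fun k hk => h k (Finset.mem_compl.mp hk)

theorem normAt_eq_of_adjacent {A : Matrix I I ℤ} (hA : IsSimplyLacedCartan A)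
    {w₀ : Function.End (I → ℤ)} {ν : ℕ} {K : Type*} [CommGroup K] [AddCommSemigroup K]
    (h : I) {p q : (Fin ν → I) × (Fin ν → K)} (hpq : Adjacent A w₀ ν p q) :
    normAt A p.1 p.2 h = normAt A q.1 q.2 h := by
  obtain ⟨f, a⟩ := p
  obtain ⟨g, b⟩ := q
  obtain ⟨-, -, ⟨l, h0, h1, h2, hij, f2, g0, g1, g2, off, b0, b1, b2⟩ |
    ⟨l, h0, h1, hij, g0, g1, off, b0, b1⟩⟩ := hpq
  · dsimp only at *
    have hji := (hA.symm _ _).trans hij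
    have pre_le : ∀ k (hk : k ≤ l), prefixProd A f k (hk.trans h0.le) =
        prefixProd A g k (hk.trans h0.le) := fun k hk =>
      prefixProd_congr_of_le A (Nat.zero_le k) _ rfl fun m _ hm =>
        (off m (by omega) (by omega) (by omega)).1.symm
    have pre_l3 : prefixProd A f (l + 3) h2 = prefixProd A g (l + 3) h2 := by
      simp only [prefixProd_succ A _ _ h2, prefixProd_succ A _ _ h1, prefixProd_succ A _ _ h0]
      rw [g0, g1, g2, f2, pre_le l le_rfl, mul_assoc, mul_assoc, mul_assoc, mul_assoc,
        ← mul_assoc (sE A _), ← mul_assoc (sE A _),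
        sE_braid (hA.diag _) (hA.diag _) hij hji]
    have key : ∀ (P : Function.End (I → ℤ)) (i j : I), A i j = -1 →
        (P * sE A i) (Pi.single j 1) = P (Pi.single i 1 + Pi.single j 1) := by
      intro P i j e
      change P (sE A i _) = _
      rw [sE_single, e]
      congr 1
      module
    have key' : ∀ (P : Function.End (I → ℤ)) (i j : I), A i j = -1 → A j i = -1 →
        (P * sE A i * sE A j) (Pi.single i 1) = P (Pi.single j 1) := by
      intro P i j e e'
      change P (sE A i (sE A j _)) = _
      rw [sE_single, e', neg_one_smul, sub_neg_eq_add, sE_add, sE_single, sE_single, e,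
        hA.diag]
      congr 1
      module
    unfold normAt
    refine prod_eq_prod_of_eq_off {⟨l, h0⟩, ⟨l + 1, h1⟩, ⟨l + 2, h2⟩} ?_ fun k hk => ?_
    · rw [Finset.prod_insert (by simp), Finset.prod_pair (by simp),
        Finset.prod_insert (by simp), Finset.prod_pair (by simp)]
      simp only [rCoef_eq_prefixProd, prefixProd_succ A _ _ h1, prefixProd_succ A _ _ h0]
      rw [b0, b1, b2, g0, g1, g2, f2, key' _ _ _ hij hji, key' _ _ _ hji hij, key _ _ _ hij,
        key _ _ _ hji, prefixProd_add, prefixProd_add, pre_le l le_rfl]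
      apply Additive.ofMul.injective
      simp only [Pi.add_apply, ofMul_mul, ofMul_zpow, ofMul_inv]
      module
    · simp only [Finset.mem_insert, Finset.mem_singleton, not_or, Fin.ext_iff] at hk
      obtain ⟨k, hkν⟩ := k
      obtain ⟨hk0, hk1, hk2⟩ := hk
      obtain ⟨e, e'⟩ := off ⟨k, hkν⟩ hk0 hk1 hk2
      dsimp only at hk0 hk1 hk2
      rw [rCoef_eq_prefixProd, rCoef_eq_prefixProd, e, e']
      rcases le_or_gt k l with hkl | hkl
      · rw [pre_le k hkl]
      · rw [prefixProd_congr_of_le A (by omega : l + 3 ≤ k) hkν.le pre_l3 fun m hm _ =>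
          (off m (by omega) (by omega) (by omega)).1.symm]
  · dsimp only at *
    have hji := (hA.symm _ _).trans hij
    have pre_le : ∀ k (hk : k ≤ l), prefixProd A f k (hk.trans h0.le) =
        prefixProd A g k (hk.trans h0.le) := fun k hk =>
      prefixProd_congr_of_le A (Nat.zero_le k) _ rfl fun m _ hm =>
        (off m (by omega) (by omega)).1.symm
    have pre_l2 : prefixProd A f (l + 2) h1 = prefixProd A g (l + 2) h1 := by
      simp only [prefixProd_succ A _ _ h1, prefixProd_succ A _ _ h0]
      rw [g0, g1, pre_le l le_rfl, mul_assoc, mul_assoc, sE_commute hij hji]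
    have key : ∀ (P : Function.End (I → ℤ)) (i j : I), A i j = 0 →
        (P * sE A i) (Pi.single j 1) = P (Pi.single j 1) := by
      intro P i j e
      change P (sE A i _) = _
      rw [sE_single, e, zero_smul, sub_zero]
    unfold normAt
    refine prod_eq_prod_of_eq_off {⟨l, h0⟩, ⟨l + 1, h1⟩} ?_ fun k hk => ?_
    · rw [Finset.prod_pair (by simp), Finset.prod_pair (by simp)]
      simp only [rCoef_eq_prefixProd, prefixProd_succ A _ _ h0]
      rw [b0, b1, g0, g1, key _ _ _ hij, key _ _ _ hji, pre_le l le_rfl, mul_comm]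
    · simp only [Finset.mem_insert, Finset.mem_singleton, not_or, Fin.ext_iff] at hk
      obtain ⟨k, hkν⟩ := k
      obtain ⟨hk0, hk1⟩ := hk
      obtain ⟨e, e'⟩ := off ⟨k, hkν⟩ hk0 hk1
      dsimp only at hk0 hk1
      rw [rCoef_eq_prefixProd, rCoef_eq_prefixProd, e, e']
      rcases le_or_gt k l with hkl | hkl
      · rw [pre_le k hkl]
      · rw [prefixProd_congr_of_le A (by omega : l + 2 ≤ k) hkν.le pre_l2 fun m hm _ =>
          (off m (by omega) (by omega)).1.symm]

/-- if `(i,a) ∼ (i',a')` in `ℐ × K^ν` then `‖i,a‖_h = ‖i',a'‖_h`;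
hence `‖A‖_h` is well defined for `A ∈ 𝒰_K`. -/
theorem norm_well_defined (A : Matrix I I ℤ) (hA : IsSimplyLacedCartan A)
    (w₀ : Function.End (I → ℤ)) (ν : ℕ) (hw : IsLongest A w₀ ν)
    {K : Type*} [CommGroup K] [AddCommSemigroup K]
    (hdist : ∀ a b c : K, a * (b + c) = a * b + a * c)
    (h : I) (p q : (Fin ν → I) × (Fin ν → K))
    (hpq : Relation.EqvGen (Adjacent A w₀ ν) p q) :
    normAt A p.1 p.2 h = normAt A q.1 q.2 h := by
  induction hpq with
  | rel p q hpq => exact normAt_eq_of_adjacent hA h hpq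
  | refl p => rfl
  | symm p q _ ih => exact ih.symm
  | trans p q r _ _ ih₁ ih₂ => exact ih₁.trans ih₂

end Lusztig
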